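/- Fix α ∈ (1,2) and N ∈ ℕ. There is a constant C = C(N, α) > 0 with the following property. For all measurable F, A : ℝ⁵ → E with ∫_{ℝ⁵}‖F‖² < ∞ and ∫_{ℝ⁵}‖A‖² < ∞ there exist functions o_F, o_A : (0,∞) → [0,∞) with o_F(r) → 0 and o_A(r) → 0 as r → 0⁺, such that: for every r > 0 and every finite family of points x_1, …, x_m in the closed ball of radius 2 centered at 0 in ℝ⁵ with the property that every point of ℝ⁵ belongs to at most N of the closed balls B̄(x_i, αr), there exist radii r_i ∈ [r, αr] (1 ≤ i ≤ m) satisfying simultaneously: (a) r·Σ_i I_F(x_i, r_i) ≤ C·∫_{ℝ⁵}‖F‖²; (b) r·Σ_i I_A(x_i, r_i) ≤ C·∫_{ℝ⁵}‖A‖²; (c) r·Σ_i I_{F − F̄_i}(x_i, r_i) ≤ o_F(r); (d) r·Σ_i I_{A − Ā_i}(x_i, r_i) ≤ o_A(r); where F̄_i := (1/|B(x_i, αr)|)∫_{B(x_i, αr)} F and Ā_i := (1/|B(x_i, αr)|)∫_{B(x_i, αr)} A are the averages over the ball B(x_i, αr), and F − F̄_i denotes the function y ↦ F(y) − F̄_i.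 -/

import Mathlib

open MeasureTheory Metric Set Filter

/-- A measure `σ` on the unit sphere `S⁴ ⊂ ℝ⁵` is the canonical surface measure,
normalized so that the polar-coordinates formula holds. -/
def IsPolarMeasure (σ : Measure (Metric.sphere (0 : EuclideanSpace ℝ (Fin 5)) 1)) : Prop :=
  ∀ g : EuclideanSpace ℝ (Fin 5) → ENNReal, Measurable g →
    ∀ (x : EuclideanSpace ℝ (Fin 5)) (a b : ℝ), 0 ≤ a → a ≤ b →
      (∫⁻ y in {y : EuclideanSpace ℝ (Fin 5) | dist y x ∈ Set.Icc a b}, g y) =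
        ∫⁻ ρ in Set.Icc a b,
          (∫⁻ ω, g (x + ρ • (ω : EuclideanSpace ℝ (Fin 5))) ∂σ) * ENNReal.ofReal (ρ ^ 4)

/-- The boundary energy `I_G(x, ρ) = ∫_{S⁴} ‖G(x + ρω)‖² ρ⁴ dσ(ω)` of `G` through the
sphere `∂B(x, ρ)`. -/
noncomputable def bdryEnergy {E : Type*} [NormedAddCommGroup E]
    (σ : Measure (Metric.sphere (0 : EuclideanSpace ℝ (Fin 5)) 1))
    (G : EuclideanSpace ℝ (Fin 5) → E) (x : EuclideanSpace ℝ (Fin 5)) (ρ : ℝ) : ENNReal :=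
  (∫⁻ ω, ENNReal.ofReal (‖G (x + ρ • (ω : EuclideanSpace ℝ (Fin 5)))‖ ^ 2) ∂σ) *
    ENNReal.ofReal (ρ ^ 4)

/-- If finitely many measurable functions are given on a finite nonzero measure space, then
outside any given null set some point satisfies all first-moment bounds simultaneously. -/
lemma exists_notMem_null_forall_measure_mul_le {X ι : Type*} [MeasurableSpace X] [Fintype ι]
    {μ : Measure X} [IsFiniteMeasure μ] (hμ : μ ≠ 0) {f : ι → X → ENNReal}
    (hf : ∀ k, Measurable (f k)) {s : Set X} (hs : μ s = 0) :
    ∃ x, x ∉ s ∧ ∀ k, μ univ * f k x ≤ Fintype.card ι * ∫⁻ y, f k y ∂μ := by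
  set g : X → ENNReal := fun x => ∑ k, (∫⁻ y, f k y ∂μ)⁻¹ * f k x with hg
  have hg_meas : Measurable g := by fun_prop
  have hμ0 : μ univ ≠ 0 := by simpa using hμ
  have h_null : ∀ k, (∫⁻ y, f k y ∂μ) = 0 → ∀ᵐ x ∂μ, f k x = 0 := fun k hk =>
    (lintegral_eq_zero_iff (hf k)).1 hk
  have h_null' : μ {x | ¬ ∀ k, (∫⁻ y, f k y ∂μ) = 0 → f k x = 0} = 0 := by
    rw [← ae_iff, ae_all_iff]
    intro k
    by_cases hk : (∫⁻ y, f k y ∂μ) = 0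
    · simpa [hk] using h_null k hk
    · simp [hk]
  obtain ⟨x, hx, hgx⟩ := exists_notMem_null_le_laverage hμ hg_meas.aemeasurable
    (measure_union_null hs h_null')
  rw [mem_union, not_or] at hx
  refine ⟨x, hx.1, fun k => ?_⟩
  have hx0 : ∀ k, (∫⁻ y, f k y ∂μ) = 0 → f k x = 0 := by simpa using hx.2
  by_cases hk0 : (∫⁻ y, f k y ∂μ) = 0
  · simp [hx0 k hk0]
  have hcard : (0 : ENNReal) < Fintype.card ι := by
    have : Nonempty ι := ⟨k⟩
    exact_mod_cast Fintype.card_pos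
  by_cases hkt : (∫⁻ y, f k y ∂μ) = ⊤
  · simp [hkt, ENNReal.mul_top hcard.ne']
  have hg_int : ∫⁻ y, g y ∂μ ≤ Fintype.card ι := by
    rw [hg, lintegral_finsetSum _ (fun k _ => (hf k).const_mul _)]
    calc ∑ k, ∫⁻ y, (∫⁻ y, f k y ∂μ)⁻¹ * f k y ∂μ
        ≤ ∑ _k : ι, 1 := by
          refine Finset.sum_le_sum fun j _ => ?_
          rw [lintegral_const_mul _ (hf j)]
          exact ENNReal.inv_mul_le_one _
      _ = Fintype.card ι := by simp
  have h1 : μ univ * ((∫⁻ y, f k y ∂μ)⁻¹ * f k x) ≤ Fintype.card ι :=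
    calc μ univ * ((∫⁻ y, f k y ∂μ)⁻¹ * f k x)
        ≤ μ univ * g x := by
          gcongr
          exact Finset.single_le_sum (f := fun k => (∫⁻ y, f k y ∂μ)⁻¹ * f k x)
            (fun _ _ => zero_le) (Finset.mem_univ k)
      _ ≤ μ univ * ⨍⁻ y, g y ∂μ := by gcongr
      _ = ∫⁻ y, g y ∂μ := measure_mul_laverage _ _
      _ ≤ Fintype.card ι := hg_int
  calc μ univ * f k x
      = μ univ * ((∫⁻ y, f k y ∂μ)⁻¹ * f k x) * ∫⁻ y, f k y ∂μ := by
        rw [mul_assoc, mul_right_comm, ENNReal.inv_mul_cancel hk0 hkt, one_mul]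
    _ ≤ Fintype.card ι * ∫⁻ y, f k y ∂μ := by gcongr

/-- Jensen's inequality for the square of the distance to a constant. -/
lemma enorm_sub_integral_sq_le_lintegral {X E : Type*} [MeasurableSpace X]
    [NormedAddCommGroup E] [NormedSpace ℝ E] [CompleteSpace E] {μ : Measure X}
    [IsProbabilityMeasure μ] {f : X → E} (hf : Integrable f μ) (c : E) :
    ‖c - ∫ z, f z ∂μ‖ₑ ^ 2 ≤ ∫⁻ z, ‖c - f z‖ₑ ^ 2 ∂μ := by
  have hcf : Integrable (fun z => c - f z) μ := (integrable_const c).sub hf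
  have h1 : c - ∫ z, f z ∂μ = ∫ z, (c - f z) ∂μ := by
    rw [integral_sub (integrable_const c) hf]; simp
  have h2 : ‖∫ z, (c - f z) ∂μ‖ₑ ≤ eLpNorm (fun z => c - f z) 2 μ :=
    calc ‖∫ z, (c - f z) ∂μ‖ₑ ≤ ∫⁻ z, ‖c - f z‖ₑ ∂μ := enorm_integral_le_lintegral_enorm _
      _ = eLpNorm (fun z => c - f z) 1 μ := eLpNorm_one_eq_lintegral_enorm.symm
      _ ≤ _ := eLpNorm_le_eLpNorm_of_exponent_le (by norm_num) hcf.aestronglyMeasurable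
  have h3 := eLpNorm_nnreal_pow_eq_lintegral (μ := μ) (f := fun z => c - f z) (p := 2) (by simp)
  calc ‖c - ∫ z, f z ∂μ‖ₑ ^ 2 ≤ eLpNorm (fun z => c - f z) 2 μ ^ 2 := by rw [h1]; gcongr
    _ = ∫⁻ z, ‖c - f z‖ₑ ^ 2 ∂μ := by simpa using h3

/-- The squared `L²` distance between `f` and its translate by `h`. -/
noncomputable def translationDefect {V E : Type*} [NormedAddCommGroup V] [MeasureSpace V]
    [NormedAddCommGroup E] (f : V → E) (h : V) : ENNReal :=
  ∫⁻ y, ‖f y - f (y + h)‖ₑ ^ 2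

lemma translationDefect_eq_eLpNorm_sq {V E : Type*} [NormedAddCommGroup V] [MeasureSpace V]
    [NormedAddCommGroup E] (f : V → E) (h : V) :
    translationDefect f h = eLpNorm (f - f ∘ (· + h)) 2 volume ^ 2 := by
  have := eLpNorm_nnreal_pow_eq_lintegral (μ := (volume : Measure V))
    (f := f - f ∘ (· + h)) (p := 2) (by simp)
  simpa [translationDefect] using this.symm

section Translation

variable {V E : Type*} [NormedAddCommGroup V] [MeasureSpace V] [BorelSpace V]
  [(volume : Measure V).IsAddHaarMeasure] [NormedAddCommGroup E]

lemma translationDefect_le {f : V → E} (hf : MemLp f 2) (h : V) :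
    translationDefect f h ≤ (2 * eLpNorm f 2) ^ 2 := by
  have hmp : MeasurePreserving (· + h) (volume : Measure V) volume :=
    measurePreserving_add_right _ h
  have hle := eLpNorm_sub_le hf.1 (hf.1.comp_measurePreserving hmp) one_le_two
  rw [eLpNorm_comp_measurePreserving hf.1 hmp, ← two_mul] at hle
  rw [translationDefect_eq_eLpNorm_sq]
  exact pow_le_pow_left' hle 2

/-- Translation is continuous in `L²`. -/
lemma tendsto_translationDefect [ProperSpace V] {f : V → E} (hf : MemLp f 2) :
    Tendsto (translationDefect f) (nhds 0) (nhds 0) := by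
  have hmp (h : V) : MeasurePreserving (· + h) (volume : Measure V) volume :=
    measurePreserving_add_right _ h
  let G : C(V, C(V, V)) := (ContinuousMap.mk (fun p : V × V => p.2 + p.1)).curry
  have hG (h : V) : MeasurePreserving (G h) (volume : Measure V) volume := hmp h
  have : Fact ((1 : ENNReal) ≤ 2) := ⟨by norm_num⟩
  have hcont : Continuous fun h => Lp.compMeasurePreserving (G h) (hG h) (hf.toLp f) :=
    continuous_const.compMeasurePreservingLp G.continuous hG (by norm_num)
  have hdist : Tendsto (fun h => edist (hf.toLp f)
      (Lp.compMeasurePreserving (G h) (hG h) (hf.toLp f)) ^ 2) (nhds 0) (nhds 0) := by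
    have h0 : Lp.compMeasurePreserving (G 0) (hG 0) (hf.toLp f) = hf.toLp f := by
      rw [Lp.toLp_compMeasurePreserving]
      congr 1
      ext y
      simp [G]
    have h1 : Continuous fun h => edist (hf.toLp f)
        (Lp.compMeasurePreserving (G h) (hG h) (hf.toLp f)) := by fun_prop
    have := (ENNReal.continuous_pow 2).comp h1 |>.tendsto 0
    simpa [h0, Function.comp_def] using this
  refine hdist.congr fun h => ?_
  rw [translationDefect_eq_eLpNorm_sq, Lp.toLp_compMeasurePreserving, Lp.edist_toLp_toLp]
  rfl

lemma tendsto_iSup_translationDefect [ProperSpace V] {f : V → E} (hf : MemLp f 2) :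
    Tendsto (fun R : ℝ => ⨆ h ∈ ball (0 : V) R, translationDefect f h) (nhds 0) (nhds 0) := by
  rw [ENNReal.tendsto_nhds_zero]
  intro ε hε
  obtain ⟨δ, hδ, hball⟩ := Metric.eventually_nhds_iff_ball.1
    (ENNReal.tendsto_nhds_zero.1 (tendsto_translationDefect hf) ε hε)
  filter_upwards [Iio_mem_nhds hδ] with R hR
  exact iSup₂_le fun h hh => hball h (ball_subset_ball hR.le hh)

end Translation

/-- Sets of multiplicity at most `N` have total energy at most `N` times the full energy. -/
lemma sum_setLIntegral_le_of_ncard_le {X : Type*} [MeasurableSpace X] {μ : Measure X} {m N : ℕ}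
    {s : Fin m → Set X} (hs : ∀ i, MeasurableSet (s i))
    (hN : ∀ y, {i | y ∈ s i}.ncard ≤ N) {g : Fin m → X → ENNReal} {G : X → ENNReal}
    (hg : ∀ i, Measurable (g i)) (hG : Measurable G) (hgG : ∀ i y, g i y ≤ G y) :
    ∑ i, ∫⁻ y in s i, g i y ∂μ ≤ N * ∫⁻ y, G y ∂μ := by
  classical
  calc ∑ i, ∫⁻ y in s i, g i y ∂μ
      = ∫⁻ y, ∑ i, (s i).indicator (g i) y ∂μ := by
        rw [lintegral_finsetSum _ (fun i _ => (hg i).indicator (hs i))]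
        simp_rw [lintegral_indicator (hs _)]
    _ ≤ ∫⁻ y, N * G y ∂μ := by
        refine lintegral_mono fun y => ?_
        calc ∑ i, (s i).indicator (g i) y
            ≤ ∑ i, if y ∈ s i then G y else 0 := by
              refine Finset.sum_le_sum fun i _ => ?_
              rw [indicator_apply]
              split_ifs
              exacts [hgG i y, le_rfl]
          _ = ({i | y ∈ s i}.ncard : ENNReal) * G y := by
              rw [← Finset.sum_filter, Finset.sum_const, nsmul_eq_mul, Set.ncard_eq_toFinset_card']
              simp
          _ ≤ N * G y := by gcongr; exact_mod_cast hN y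
    _ = N * ∫⁻ y, G y ∂μ := lintegral_const_mul _ hG

/-- The total mean oscillation of an `L²` function over boundedly overlapping balls is
controlled by its `L²` modulus of continuity. -/
lemma sum_oscillation_le {V E : Type*} [NormedAddCommGroup V] [NormedSpace ℝ V]
    [FiniteDimensional ℝ V] [MeasureSpace V] [BorelSpace V]
    [(volume : Measure V).IsAddHaarMeasure] [NormedAddCommGroup E] [NormedSpace ℝ E]
    [FiniteDimensional ℝ E] [MeasurableSpace E] [BorelSpace E]
    {f : V → E} (hfm : Measurable f) (hf : MemLp f 2) {R : ℝ} (hR : 0 < R) {m N : ℕ}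
    (x : Fin m → V) (hN : ∀ y, {i | y ∈ closedBall (x i) R}.ncard ≤ N) :
    ∑ i, ∫⁻ y in closedBall (x i) R, ‖f y - ⨍ z in ball (x i) R, f z‖ₑ ^ 2 ≤
      N * (2 ^ Module.finrank ℝ V * ⨆ h ∈ ball (0 : V) (2 * R), translationDefect f h) := by
  set b : ENNReal := volume (ball (0 : V) R)
  have hb (c : V) : volume (ball c R) = b := Measure.addHaar_ball_center _ c R
  have hb0 : b ≠ 0 := (measure_ball_pos _ _ hR).ne'
  have hbt : b ≠ ⊤ := measure_ball_lt_top.ne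
  set k : V → V → ENNReal := fun y h => (ball (0 : V) (2 * R)).indicator
    (fun h => ‖f y - f (y + h)‖ₑ ^ 2) h
  have hk_meas : Measurable (Function.uncurry k) := by
    have : Function.uncurry k = (univ ×ˢ ball (0 : V) (2 * R)).indicator
        (fun p : V × V => ‖f p.1 - f (p.1 + p.2)‖ₑ ^ 2) := by
      ext ⟨y, h⟩
      by_cases hh : h ∈ ball (0 : V) (2 * R)
      · simp only [Function.uncurry, k, indicator_of_mem hh,
          indicator_of_mem (mk_mem_prod (mem_univ y) hh)]
      · simp only [Function.uncurry, k, indicator_of_notMem hh,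
          indicator_of_notMem fun h' : (y, h) ∈ univ ×ˢ ball (0 : V) (2 * R) => hh h'.2]
    rw [this]
    exact Measurable.indicator (by fun_prop) (MeasurableSet.univ.prod measurableSet_ball)
  have hmean (i : Fin m) {y : V} (hy : y ∈ closedBall (x i) R) :
      ‖f y - ⨍ z in ball (x i) R, f z‖ₑ ^ 2 ≤ b⁻¹ * ∫⁻ h, k y h := by
    have : IsProbabilityMeasure
        ((volume (ball (x i) R))⁻¹ • (volume : Measure V).restrict (ball (x i) R)) := by
      refine ⟨?_⟩
      simp [hb, ENNReal.inv_mul_cancel hb0 hbt]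
    rw [setAverage_eq']
    have hint : Integrable f
        ((volume (ball (x i) R))⁻¹ • (volume : Measure V).restrict (ball (x i) R)) := by
      refine Integrable.smul_measure ?_ (by simp [hb, hb0])
      have : IsFiniteMeasure ((volume : Measure V).restrict (ball (x i) R)) :=
        ⟨by simpa using measure_ball_lt_top⟩
      exact (hf.restrict _).integrable (by norm_num)
    refine (enorm_sub_integral_sq_le_lintegral hint (f y)).trans ?_
    rw [lintegral_smul_measure, hb, smul_eq_mul]
    refine mul_le_mul_right ?_ _
    rw [← lintegral_add_left_eq_self (μ := volume) (k y) (-y), ← lintegral_indicator measurableSet_ball]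
    refine lintegral_mono fun z => ?_
    by_cases hz : z ∈ ball (x i) R
    · have : -y + z ∈ ball (0 : V) (2 * R) := by
        rw [mem_ball_zero_iff, neg_add_eq_sub, ← dist_eq_norm]
        rw [mem_ball] at hz
        rw [mem_closedBall, dist_comm] at hy
        linarith [dist_triangle z (x i) y]
      simp [k, hz, indicator_of_mem this]
    · simp [hz]
  calc ∑ i, ∫⁻ y in closedBall (x i) R, ‖f y - ⨍ z in ball (x i) R, f z‖ₑ ^ 2
      ≤ ∑ i, ∫⁻ y in closedBall (x i) R, b⁻¹ * ∫⁻ h, k y h :=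
        Finset.sum_le_sum fun i _ => setLIntegral_mono' measurableSet_closedBall
          fun y hy => hmean i hy
    _ ≤ N * ∫⁻ y, b⁻¹ * ∫⁻ h, k y h :=
        sum_setLIntegral_le_of_ncard_le (fun i => measurableSet_closedBall) hN
          (fun _ => hk_meas.lintegral_prod_right.const_mul _)
          (hk_meas.lintegral_prod_right.const_mul _) fun _ _ => le_rfl
    _ = N * (b⁻¹ * ∫⁻ h in ball (0 : V) (2 * R), translationDefect f h) := by
        rw [lintegral_const_mul _ hk_meas.lintegral_prod_right,
          lintegral_lintegral_swap hk_meas.aemeasurable,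
          ← lintegral_indicator measurableSet_ball]
        congr 3
        ext h
        by_cases hh : h ∈ ball (0 : V) (2 * R)
        · simp [k, indicator_of_mem hh, translationDefect]
        · simp [k, indicator_of_notMem hh]
    _ ≤ N * (b⁻¹ * ((⨆ h ∈ ball (0 : V) (2 * R), translationDefect f h) *
          volume (ball (0 : V) (2 * R)))) := by
        gcongr
        rw [← setLIntegral_const]
        exact setLIntegral_mono' measurableSet_ball fun h hh =>
          le_iSup₂ (f := fun h (_ : h ∈ ball (0 : V) (2 * R)) => translationDefect f h) h hh
    _ = N * (2 ^ Module.finrank ℝ V *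
          ⨆ h ∈ ball (0 : V) (2 * R), translationDefect f h) := by
        rw [Measure.addHaar_ball_mul_of_pos _ _ two_pos, ENNReal.ofReal_pow zero_le_two,
          ENNReal.ofReal_ofNat]
        congr 1
        calc _ = b⁻¹ * b * (2 ^ Module.finrank ℝ V *
              ⨆ h ∈ ball (0 : V) (2 * R), translationDefect f h) := by ring
          _ = _ := by rw [ENNReal.inv_mul_cancel hb0 hbt, one_mul]

lemma IsPolarMeasure.isFiniteMeasure
    {σ : Measure (Metric.sphere (0 : EuclideanSpace ℝ (Fin 5)) 1)} (hσ : IsPolarMeasure σ) :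
    IsFiniteMeasure σ := by
  have h := hσ (fun _ => 1) measurable_const 0 0 1 le_rfl zero_le_one
  simp only [lintegral_const, Measure.restrict_apply_univ, one_mul] at h
  have hsub : {y : EuclideanSpace ℝ (Fin 5) | dist y 0 ∈ Icc (0 : ℝ) 1} ⊆ closedBall 0 1 :=
    fun y hy => hy.2
  have hfin := ((measure_mono hsub).trans_lt (measure_closedBall_lt_top (μ := volume))).ne
  rw [h] at hfin
  refine ⟨lt_top_iff_ne_top.2 fun htop => hfin ?_⟩
  rw [htop, lintegral_const_mul _ (by fun_prop)]
  refine ENNReal.top_mul fun h0 => ?_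
  rw [lintegral_eq_zero_iff (by fun_prop), Filter.EventuallyEq,
    ae_restrict_iff' measurableSet_Icc] at h0
  have hvol : volume (Ioc (0 : ℝ) 1) = 0 := by
    refine measure_mono_null (fun ρ hρ => ?_) (ae_iff.1 h0)
    have : 0 < ρ ^ 4 := pow_pos hρ.1 4
    simpa [hρ.1.le, hρ.2] using this
  simp at hvol

lemma ofReal_norm_sq_eq_enorm_sq {E : Type*} [NormedAddCommGroup E] (v : E) :
    ENNReal.ofReal (‖v‖ ^ 2) = ‖v‖ₑ ^ 2 := by
  rw [ENNReal.ofReal_pow (norm_nonneg _), ofReal_norm]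

lemma measurable_bdryEnergy {E : Type*} [NormedAddCommGroup E] [MeasurableSpace E]
    [BorelSpace E] {σ : Measure (Metric.sphere (0 : EuclideanSpace ℝ (Fin 5)) 1)} [SFinite σ]
    {G : EuclideanSpace ℝ (Fin 5) → E} (hG : Measurable G) (x : EuclideanSpace ℝ (Fin 5)) :
    Measurable (bdryEnergy σ G x) := by
  unfold bdryEnergy
  refine Measurable.mul (Measurable.lintegral_prod_right ?_) (by fun_prop)
  fun_prop

lemma IsPolarMeasure.setLIntegral_bdryEnergy_le {E : Type*} [NormedAddCommGroup E]
    [MeasurableSpace E] [BorelSpace E]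
    {σ : Measure (Metric.sphere (0 : EuclideanSpace ℝ (Fin 5)) 1)} (hσ : IsPolarMeasure σ)
    {G : EuclideanSpace ℝ (Fin 5) → E} (hG : Measurable G) (x : EuclideanSpace ℝ (Fin 5))
    {a b : ℝ} (ha : 0 ≤ a) (hab : a ≤ b) :
    ∫⁻ ρ in Icc a b, bdryEnergy σ G x ρ ≤ ∫⁻ y in closedBall x b, ‖G y‖ₑ ^ 2 := by
  unfold bdryEnergy
  rw [← hσ (fun y => ENNReal.ofReal (‖G y‖ ^ 2)) (by fun_prop) x a b ha hab]
  simp_rw [ofReal_norm_sq_eq_enorm_sq]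
  exact lintegral_mono_set fun y hy => hy.2

/-- Finitely many functions admit a common radius in `[r, αr]` at which each boundary energy is
controlled by the energy in the ball. -/
lemma IsPolarMeasure.exists_radius {E ι : Type*} [NormedAddCommGroup E]
    [MeasurableSpace E] [BorelSpace E] [Fintype ι]
    {σ : Measure (Metric.sphere (0 : EuclideanSpace ℝ (Fin 5)) 1)} (hσ : IsPolarMeasure σ)
    {G : ι → EuclideanSpace ℝ (Fin 5) → E} (hG : ∀ k, Measurable (G k))
    (x : EuclideanSpace ℝ (Fin 5)) {α r : ℝ} (hα : 1 < α) (hr : 0 < r) :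
    ∃ ρ ∈ Icc r (α * r), ∀ k, ENNReal.ofReal r * bdryEnergy σ (G k) x ρ ≤
      ENNReal.ofReal (Fintype.card ι / (α - 1)) *
        ∫⁻ y in closedBall x (α * r), ‖G k y‖ₑ ^ 2 := by
  have := hσ.isFiniteMeasure
  have hα' : 0 < α - 1 := sub_pos.2 hα
  have hlen : α * r - r = (α - 1) * r := by ring
  have hlt : r < α * r := lt_mul_left hr hα
  have hne : (volume : Measure ℝ).restrict (Icc r (α * r)) ≠ 0 := by
    rw [Ne, Measure.restrict_eq_zero, Real.volume_Icc, ENNReal.ofReal_eq_zero, not_le]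
    linarith
  have hout : (volume : Measure ℝ).restrict (Icc r (α * r)) (Icc r (α * r))ᶜ = 0 := by
    rw [Measure.restrict_apply measurableSet_Icc.compl]; simp
  obtain ⟨ρ, hρ, hle⟩ := exists_notMem_null_forall_measure_mul_le hne
    (fun k => measurable_bdryEnergy (σ := σ) (hG k) x) hout
  refine ⟨ρ, by simpa using hρ, fun k => ?_⟩
  have h := hle k
  rw [Measure.restrict_apply_univ, Real.volume_Icc, hlen, ENNReal.ofReal_mul hα'.le] at h
  calc ENNReal.ofReal r * bdryEnergy σ (G k) x ρ
      = ENNReal.ofReal (α - 1)⁻¹ *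
          (ENNReal.ofReal (α - 1) * ENNReal.ofReal r * bdryEnergy σ (G k) x ρ) := by
        rw [← mul_assoc, ← mul_assoc, ← ENNReal.ofReal_mul (inv_nonneg.2 hα'.le),
          inv_mul_cancel₀ hα'.ne', ENNReal.ofReal_one, one_mul]
    _ ≤ ENNReal.ofReal (α - 1)⁻¹ *
          (Fintype.card ι * ∫⁻ ρ in Icc r (α * r), bdryEnergy σ (G k) x ρ) := by gcongr
    _ ≤ ENNReal.ofReal (α - 1)⁻¹ *
          (Fintype.card ι * ∫⁻ y in closedBall x (α * r), ‖G k y‖ₑ ^ 2) := by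
        gcongr
        exact hσ.setLIntegral_bdryEnergy_le (hG k) x hr.le hlt.le
    _ = _ := by
        rw [div_eq_inv_mul, ENNReal.ofReal_mul (inv_nonneg.2 hα'.le), ENNReal.ofReal_natCast,
          mul_assoc]

lemma memLp_two_of_lintegral_lt_top {X E : Type*} [MeasurableSpace X] [NormedAddCommGroup E]
    {μ : Measure X} {f : X → E} (hfm : AEStronglyMeasurable f μ)
    (hf : ∫⁻ y, ENNReal.ofReal (‖f y‖ ^ 2) ∂μ < ⊤) : MemLp f 2 μ := by
  refine ⟨hfm, ?_⟩
  have h := eLpNorm_nnreal_pow_eq_lintegral (μ := μ) (f := f) (p := 2) (by simp)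
  simp_rw [ofReal_norm_sq_eq_enorm_sq] at hf
  have h' : eLpNorm f 2 μ ^ 2 < ⊤ := by
    refine lt_of_eq_of_lt ?_ hf
    simpa using h
  exact (ENNReal.pow_lt_top_iff.1 h').resolve_right (by norm_num)

/-- For an `L²` function on `ℝ⁵`, the total mean oscillation over balls of radius `αr` with overlap
at most `N` is controlled by a finite quantity vanishing as `r → 0⁺`. -/
lemma exists_oscillation_modulus {E : Type*} [NormedAddCommGroup E] [NormedSpace ℝ E]
    [FiniteDimensional ℝ E] [MeasurableSpace E] [BorelSpace E] {α : ℝ} (hα : 0 < α) (N : ℕ)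
    {K : ENNReal} (hK : K ≠ ⊤) {f : EuclideanSpace ℝ (Fin 5) → E} (hfm : Measurable f)
    (hf : MemLp f 2) :
    ∃ o : ℝ → ℝ, (∀ r, 0 ≤ o r) ∧ Tendsto o (nhdsWithin 0 (Ioi 0)) (nhds 0) ∧
      ∀ r, 0 < r → ∀ (m : ℕ) (x : Fin m → EuclideanSpace ℝ (Fin 5)),
        (∀ y, {i | y ∈ closedBall (x i) (α * r)}.ncard ≤ N) →
        K * ∑ i, ∫⁻ y in closedBall (x i) (α * r),
          ‖f y - ⨍ z in ball (x i) (α * r), f z‖ₑ ^ 2 ≤ ENNReal.ofReal (o r) := by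
  set M : ℝ → ENNReal := fun R =>
    ⨆ h ∈ ball (0 : EuclideanSpace ℝ (Fin 5)) R, translationDefect f h
  set D : ENNReal := K * (N * 2 ^ Module.finrank ℝ (EuclideanSpace ℝ (Fin 5)))
  have hD : D ≠ ⊤ := by finiteness
  have hM_top (R : ℝ) : M R ≠ ⊤ := by
    have hle : M R ≤ (2 * eLpNorm f 2 volume) ^ 2 :=
      iSup₂_le fun h _ => translationDefect_le hf h
    have hfin := hf.eLpNorm_ne_top
    exact ne_top_of_le_ne_top (by finiteness) hle
  refine ⟨fun r => (D * M (2 * (α * r))).toReal, fun _ => ENNReal.toReal_nonneg, ?_, ?_⟩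
  · have h1 : Tendsto (fun r : ℝ => 2 * (α * r)) (nhdsWithin 0 (Ioi 0)) (nhds 0) := by
      have : Continuous fun r : ℝ => 2 * (α * r) := by fun_prop
      simpa using (this.tendsto 0).mono_left nhdsWithin_le_nhds
    have h2 : Tendsto (fun r : ℝ => D * M (2 * (α * r))) (nhdsWithin 0 (Ioi 0)) (nhds 0) := by
      have h3 : Tendsto (fun r : ℝ => M (2 * (α * r))) (nhdsWithin 0 (Ioi 0)) (nhds 0) :=
        (tendsto_iSup_translationDefect hf).comp h1
      rw [← mul_zero D]
      exact ENNReal.Tendsto.const_mul h3 (Or.inr hD)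
    rw [← ENNReal.toReal_zero]
    exact (ENNReal.tendsto_toReal ENNReal.zero_ne_top).comp h2
  · intro r hr m x hN
    rw [ENNReal.ofReal_toReal (ENNReal.mul_ne_top hD (hM_top _))]
    calc _ ≤ K * (N * (2 ^ Module.finrank ℝ (EuclideanSpace ℝ (Fin 5)) * M (2 * (α * r)))) := by
          gcongr
          exact sum_oscillation_le hfm hf (mul_pos hα hr) x hN
      _ = D * M (2 * (α * r)) := by simp only [D, mul_assoc]

/-- Proposition 4.4 of the paper: existence of good grid radii. -/
theorem good_grid_radii {E : Type*} [NormedAddCommGroup E] [NormedSpace ℝ E]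
    [FiniteDimensional ℝ E] [MeasurableSpace E] [BorelSpace E]
    (α : ℝ) (hα1 : 1 < α) (hα2 : α < 2) (N : ℕ)
    (σ : Measure (Metric.sphere (0 : EuclideanSpace ℝ (Fin 5)) 1)) (hσ : IsPolarMeasure σ) :
    ∃ C : ℝ, 0 < C ∧
      ∀ (F A : EuclideanSpace ℝ (Fin 5) → E), Measurable F → Measurable A →
      (∫⁻ y, ENNReal.ofReal (‖F y‖ ^ 2)) < ⊤ → (∫⁻ y, ENNReal.ofReal (‖A y‖ ^ 2)) < ⊤ →
      ∃ oF oA : ℝ → ℝ,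
        (∀ r, 0 ≤ oF r) ∧ (∀ r, 0 ≤ oA r) ∧
        Tendsto oF (nhdsWithin 0 (Set.Ioi 0)) (nhds 0) ∧
        Tendsto oA (nhdsWithin 0 (Set.Ioi 0)) (nhds 0) ∧
        ∀ (r : ℝ), 0 < r → ∀ (m : ℕ) (x : Fin m → EuclideanSpace ℝ (Fin 5)),
          (∀ i, x i ∈ Metric.closedBall (0 : EuclideanSpace ℝ (Fin 5)) 2) →
          (∀ y : EuclideanSpace ℝ (Fin 5),
            ({i : Fin m | y ∈ Metric.closedBall (x i) (α * r)}).ncard ≤ N) →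
          ∃ rad : Fin m → ℝ, (∀ i, rad i ∈ Set.Icc r (α * r)) ∧
            ENNReal.ofReal r * ∑ i, bdryEnergy σ F (x i) (rad i)
              ≤ ENNReal.ofReal C * ∫⁻ y, ENNReal.ofReal (‖F y‖ ^ 2) ∧
            ENNReal.ofReal r * ∑ i, bdryEnergy σ A (x i) (rad i)
              ≤ ENNReal.ofReal C * ∫⁻ y, ENNReal.ofReal (‖A y‖ ^ 2) ∧
            ENNReal.ofReal r * ∑ i, bdryEnergy σ
                (fun y => F y - ⨍ z in Metric.ball (x i) (α * r), F z) (x i) (rad i)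
              ≤ ENNReal.ofReal (oF r) ∧
            ENNReal.ofReal r * ∑ i, bdryEnergy σ
                (fun y => A y - ⨍ z in Metric.ball (x i) (α * r), A z) (x i) (rad i)
              ≤ ENNReal.ofReal (oA r) := by
  have hα0 : 0 < α - 1 := sub_pos.2 hα1
  have hαpos : 0 < α := by linarith
  refine ⟨4 / (α - 1) * (N + 1), by positivity, fun F A hF hA hF2 hA2 => ?_⟩
  obtain ⟨oF, hoF, hoF_tendsto, hoF_le⟩ := exists_oscillation_modulus hαpos N
    (K := ENNReal.ofReal (4 / (α - 1))) ENNReal.ofReal_ne_top hF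
    (memLp_two_of_lintegral_lt_top hF.aestronglyMeasurable hF2)
  obtain ⟨oA, hoA, hoA_tendsto, hoA_le⟩ := exists_oscillation_modulus hαpos N
    (K := ENNReal.ofReal (4 / (α - 1))) ENNReal.ofReal_ne_top hA
    (memLp_two_of_lintegral_lt_top hA.aestronglyMeasurable hA2)
  refine ⟨oF, oA, hoF, hoA, hoF_tendsto, hoA_tendsto, fun r hr m x _ hN => ?_⟩
  let G (i : Fin m) : Fin 4 → EuclideanSpace ℝ (Fin 5) → E :=
    ![F, A, fun y => F y - ⨍ z in ball (x i) (α * r), F z,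
      fun y => A y - ⨍ z in ball (x i) (α * r), A z]
  have hG (i : Fin m) (k : Fin 4) : Measurable (G i k) := by
    fin_cases k
    exacts [hF, hA, hF.sub_const _, hA.sub_const _]
  choose rad hrad hle using fun i => hσ.exists_radius (hG i) (x i) hα1 hr
  simp only [Fintype.card_fin, Nat.cast_ofNat] at hle
  have hsum (k : Fin 4) : ENNReal.ofReal r * ∑ i, bdryEnergy σ (G i k) (x i) (rad i) ≤
      ENNReal.ofReal (4 / (α - 1)) *
        ∑ i, ∫⁻ y in closedBall (x i) (α * r), ‖G i k y‖ₑ ^ 2 := by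
    rw [Finset.mul_sum, Finset.mul_sum]
    exact Finset.sum_le_sum fun i _ => hle i k
  have henergy {f : EuclideanSpace ℝ (Fin 5) → E} (hf : Measurable f) :
      ENNReal.ofReal (4 / (α - 1)) *
        ∑ i, ∫⁻ y in closedBall (x i) (α * r), ‖f y‖ₑ ^ 2 ≤
      ENNReal.ofReal (4 / (α - 1) * (N + 1)) * ∫⁻ y, ENNReal.ofReal (‖f y‖ ^ 2) := by
    simp_rw [ofReal_norm_sq_eq_enorm_sq]
    rw [ENNReal.ofReal_mul (by positivity), mul_assoc]
    gcongr
    refine (sum_setLIntegral_le_of_ncard_le (fun i => measurableSet_closedBall) hN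
      (g := fun _ y => ‖f y‖ₑ ^ 2) (fun _ => by fun_prop) (by fun_prop) fun _ _ => le_rfl).trans ?_
    gcongr
    rw [← ENNReal.ofReal_natCast]
    exact ENNReal.ofReal_le_ofReal (by linarith)
  exact ⟨rad, hrad, (hsum 0).trans (henergy hF), (hsum 1).trans (henergy hA),
    (hsum 2).trans (hoF_le r hr m x hN), (hsum 3).trans (hoA_le r hr m x hN)⟩
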